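/- For any labelled Markov chain (X,L,τ,l) and any [0,1]-valued pseudometric d on X, the function Γ(d) defined by Γ(d)(x,y) = 1 if l(x) ≠ l(y), and Γ(d)(x,y) = sup over all h : X → [0,1] nonexpansive from (X,d) to ([0,1], euclidean distance) of (τ(x) ⊨ h − τ(y) ⊨ h) otherwise, is again a [0,1]-valued pseudometric on X (it vanishes on the diagonal, is symmetric, and satisfies the triangle inequality). -/

import Mathlib

/-- A finitely supported, rational-valued probability distribution on `X`. -/
structure FinDist (X : Type*) where
  p : X → ℝ
  nonneg : ∀ x, 0 ≤ p x
  rat : ∀ x, ∃ q : ℚ, (q : ℝ) = p x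
  supp : Finset X
  mem_supp : ∀ x, x ∈ supp ↔ p x ≠ 0
  sum_one : ∑ x ∈ supp, p x = 1

/-- A labelled Markov chain with states `X` and labels `L`. -/
structure LMC (X : Type*) (L : Type*) where
  τ : X → FinDist X
  label : X → L

/-- Expectation `μ ⊨ h = ∑ x, μ(x)·h(x)`. -/
noncomputable def expv {X : Type*} (μ : FinDist X) (h : X → ℝ) : ℝ :=
  ∑ z ∈ μ.supp, μ.p z * h z

/-- A `[0,1]`-valued pseudometric on `X`. -/
structure PMet (X : Type*) where
  d : X → X → ℝ
  nonneg : ∀ x y, 0 ≤ d x y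
  le_one : ∀ x y, d x y ≤ 1
  refl : ∀ x, d x x = 0
  symm : ∀ x y, d x y = d y x
  triangle : ∀ x y z, d x z ≤ d x y + d y z

open Classical in
/-- The functional `Γ` (on underlying distance functions). -/
noncomputable def GammaFun {X L : Type*} (M : LMC X L) (d : X → X → ℝ) : X → X → ℝ :=
  fun x y =>
    if M.label x ≠ M.label y then 1
    else sSup { r : ℝ | ∃ h : X → ℝ, (∀ z, h z ∈ Set.Icc (0:ℝ) 1) ∧
      (∀ u v, |h u - h v| ≤ d u v) ∧ r = expv (M.τ x) h - expv (M.τ y) h }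

theorem expv_nonneg_aux {X : Type*} (μ : FinDist X) (h : X → ℝ)
    (hh : ∀ z, h z ∈ Set.Icc (0:ℝ) 1) : 0 ≤ expv μ h :=
  Finset.sum_nonneg fun z _ => mul_nonneg (μ.nonneg z) (hh z).1

theorem expv_le_one_aux {X : Type*} (μ : FinDist X) (h : X → ℝ)
    (hh : ∀ z, h z ∈ Set.Icc (0:ℝ) 1) : expv μ h ≤ 1 := by
  rw [← μ.sum_one]
  exact Finset.sum_le_sum fun z _ => mul_le_of_le_one_right (μ.nonneg z) (hh z).2

theorem expv_compl_aux {X : Type*} (μ : FinDist X) (h : X → ℝ) :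
    expv μ (fun z => 1 - h z) = 1 - expv μ h := by
  unfold expv
  simp only [mul_sub, mul_one, Finset.sum_sub_distrib, μ.sum_one]

/-- The set of which the supremum is taken. -/
def gSet {X L : Type*} (M : LMC X L) (d : X → X → ℝ) (x y : X) : Set ℝ :=
  { r : ℝ | ∃ h : X → ℝ, (∀ z, h z ∈ Set.Icc (0:ℝ) 1) ∧
      (∀ u v, |h u - h v| ≤ d u v) ∧ r = expv (M.τ x) h - expv (M.τ y) h }

theorem gSet_le_one {X L : Type*} (M : LMC X L) (d : X → X → ℝ) (x y : X) :
    ∀ r ∈ gSet M d x y, r ≤ 1 := by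
  rintro r ⟨h, h1, h2, rfl⟩
  linarith [expv_nonneg_aux (M.τ y) h h1, expv_le_one_aux (M.τ x) h h1]

theorem gSet_zero {X L : Type*} (M : LMC X L) (dm : PMet X) (x y : X) :
    (0:ℝ) ∈ gSet M dm.d x y :=
  ⟨fun _ => 0, fun _ => by simp, fun u v => by simpa using dm.nonneg u v, by simp [expv]⟩

theorem gSet_symm {X L : Type*} (M : LMC X L) (d : X → X → ℝ) (x y : X) :
    gSet M d x y ⊆ gSet M d y x := by
  rintro r ⟨h, h1, h2, rfl⟩
  refine ⟨fun z => 1 - h z, fun z => ⟨?_, ?_⟩, fun u v => ?_, ?_⟩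
  · linarith [(h1 z).2]
  · linarith [(h1 z).1]
  · have := h2 u v
    rw [abs_sub_comm] at this
    convert this using 2
    ring
  · rw [expv_compl_aux, expv_compl_aux]; ring

theorem gamma_ne {X L : Type*} (M : LMC X L) (d : X → X → ℝ) (x y : X)
    (h : M.label x ≠ M.label y) : GammaFun M d x y = 1 := by
  unfold GammaFun
  exact if_pos h

theorem gamma_eq {X L : Type*} (M : LMC X L) (d : X → X → ℝ) (x y : X)
    (h : M.label x = M.label y) : GammaFun M d x y = sSup (gSet M d x y) := by
  unfold GammaFun
  exact if_neg (not_not.mpr h)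

/-- `Γ(d)` is again a `[0,1]`-valued pseudometric. -/
theorem gamma_isPMet {X L : Type*} [Nonempty L] (M : LMC X L) (dm : PMet X) :
    (∀ x y, 0 ≤ GammaFun M dm.d x y) ∧
    (∀ x y, GammaFun M dm.d x y ≤ 1) ∧
    (∀ x, GammaFun M dm.d x x = 0) ∧
    (∀ x y, GammaFun M dm.d x y = GammaFun M dm.d y x) ∧
    (∀ x y z, GammaFun M dm.d x z ≤ GammaFun M dm.d x y + GammaFun M dm.d y z) := by
  have bdd : ∀ x y, BddAbove (gSet M dm.d x y) := fun x y => ⟨1, gSet_le_one M dm.d x y⟩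
  have h0 : ∀ x y, 0 ≤ GammaFun M dm.d x y := by
    intro x y
    by_cases h : M.label x = M.label y
    · rw [gamma_eq M _ x y h]
      exact le_csSup (bdd x y) (gSet_zero M dm x y)
    · rw [gamma_ne M _ x y h]; exact zero_le_one
  have h1 : ∀ x y, GammaFun M dm.d x y ≤ 1 := by
    intro x y
    by_cases h : M.label x = M.label y
    · rw [gamma_eq M _ x y h]
      exact csSup_le ⟨0, gSet_zero M dm x y⟩ (gSet_le_one M dm.d x y)
    · rw [gamma_ne M _ x y h]
  refine ⟨h0, h1, ?_, ?_, ?_⟩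
  · intro x
    refine le_antisymm ?_ (h0 x x)
    rw [gamma_eq M _ x x rfl]
    refine csSup_le ⟨0, gSet_zero M dm x x⟩ ?_
    rintro r ⟨h, -, -, rfl⟩
    simp
  · intro x y
    by_cases h : M.label x = M.label y
    · rw [gamma_eq M _ x y h, gamma_eq M _ y x h.symm,
        (gSet_symm M dm.d x y).antisymm (gSet_symm M dm.d y x)]
    · rw [gamma_ne M _ x y h, gamma_ne M _ y x (Ne.symm h)]
  · intro x y z
    by_cases hxy : M.label x = M.label y
    · by_cases hyz : M.label y = M.label z
      · rw [gamma_eq M _ x y hxy, gamma_eq M _ y z hyz, gamma_eq M _ x z (hxy.trans hyz)]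
        refine csSup_le ⟨0, gSet_zero M dm x z⟩ ?_
        rintro r ⟨h, a, b, rfl⟩
        have e1 := le_csSup (bdd x y) ⟨h, a, b, rfl⟩
        have e2 := le_csSup (bdd y z) ⟨h, a, b, rfl⟩
        linarith
      · rw [gamma_ne M _ y z hyz]
        linarith [h0 x y, h1 x z]
    · rw [gamma_ne M _ x y hxy]
      linarith [h0 y z, h1 x z]
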